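/- Let X be a plane dendroid smooth at p, let e ∈ E(X) \ {p}, and let x ∈ X \ α(e,p). Then there is a simple closed curve σ ⊂ ℝ² which separates e from x, such that |σ ∩ E(X)| ≤ 2 and p ∉ σ ∩ E(X). -/

import Mathlib

open Set Filter Topology

/-- The Euclidean plane. -/
abbrev Plane := EuclideanSpace ℝ (Fin 2)

section Defs

variable {α : Type*} [TopologicalSpace α]

/-- `A` is an arc with endpoints `a` and `b`: a homeomorphic image of `[0,1]`
sending `0 ↦ a` and `1 ↦ b`. -/
def IsArcWithEndpoints (A : Set α) (a b : α) : Prop :=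
  ∃ f : ℝ → α, ContinuousOn f (Set.Icc 0 1) ∧ Set.InjOn f (Set.Icc 0 1) ∧
    f '' (Set.Icc 0 1) = A ∧ f 0 = a ∧ f 1 = b

/-- `A` is an arc. -/
def IsArc (A : Set α) : Prop := ∃ a b, IsArcWithEndpoints A a b

/-- Every two distinct points of `X` are joined by an arc inside `X`. -/
def ArcwiseConnected (X : Set α) : Prop :=
  ∀ x ∈ X, ∀ y ∈ X, x ≠ y → ∃ A, A ⊆ X ∧ IsArcWithEndpoints A x y

/-- Every two subcontinua of `X` have connected intersection. -/
def HereditarilyUnicoherent (X : Set α) : Prop :=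
  ∀ K L : Set α, K ⊆ X → L ⊆ X → IsCompact K → IsConnected K →
    IsCompact L → IsConnected L → IsPreconnected (K ∩ L)

/-- A dendroid: a hereditarily unicoherent, arcwise connected continuum. -/
def IsDendroid (X : Set α) : Prop :=
  IsCompact X ∧ IsConnected X ∧ HereditarilyUnicoherent X ∧ ArcwiseConnected X

/-- The set of endpoints of `X`: points that are endpoints of every arc in `X`
containing them. -/
def Endpoints (X : Set α) : Set α :=
  {e | e ∈ X ∧ ∀ A : Set α, A ⊆ X → IsArc A → e ∈ A → ∃ b, IsArcWithEndpoints A e b}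

/-- `X` is Suslinian: every collection of pairwise-disjoint non-degenerate
subcontinua of `X` is countable. -/
def IsSuslinian (X : Set α) : Prop :=
  ∀ S : Set (Set α), (∀ K ∈ S, K ⊆ X ∧ IsCompact K ∧ IsConnected K ∧ K.Nontrivial) →
    S.PairwiseDisjoint id → S.Countable

/-- The arc component of `x` inside the set `S`. -/
def arcComponentIn (S : Set α) (x : α) : Set α :=
  {y | y ∈ S ∧ (y = x ∨ ∃ A, A ⊆ S ∧ IsArcWithEndpoints A x y)}

/-- The collection of arc components of `X \ {x}`; its cardinality is the order of `x`. -/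
def orderComponents (X : Set α) (x : α) : Set (Set α) :=
  {C | ∃ y ∈ X \ {x}, C = arcComponentIn (X \ {x}) y}

/-- Ramification points of `X`: points of order at least 3. -/
def RamificationPoints (X : Set α) : Set α :=
  {x | x ∈ X ∧ 3 ≤ (orderComponents X x).encard}

/-- `A` is a clopen subset of the subspace `Y`. -/
def IsClopenIn (Y A : Set α) : Prop :=
  A ⊆ Y ∧ (∃ U, IsOpen U ∧ A = Y ∩ U) ∧ (∃ C, IsClosed C ∧ A = Y ∩ C)

/-- The quasicomponent of `x` in the subspace `Y`: the intersection of all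
clopen subsets of `Y` containing `x`. -/
def quasicomponentIn (Y : Set α) (x : α) : Set α :=
  {y ∈ Y | ∀ A : Set α, IsClopenIn Y A → x ∈ A → y ∈ A}

/-- `Y` is hereditarily disconnected: it contains no non-degenerate connected subset. -/
def HereditarilyDisconnected (Y : Set α) : Prop :=
  ∀ S : Set α, S ⊆ Y → IsPreconnected S → S.Subsingleton

end Defs

/-- The point `x` of `X` is (arcwise) accessible from `ℝ² \ X`. -/
def AccessiblePoint (X : Set Plane) (x : Plane) : Prop :=
  ∃ A : Set Plane, IsArc A ∧ A ∩ X = {x}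

/-- `σ` separates the points `b` and `d` in the plane: no connected subset of the
complement of `σ` contains both. -/
def SeparatesPoints (σ : Set Plane) (b d : Plane) : Prop :=
  b ∉ σ ∧ d ∉ σ ∧ ∀ K : Set Plane, K ⊆ σᶜ → IsPreconnected K → b ∈ K → d ∉ K

/-- A simple closed curve in the plane: the image of a period-1 parametrization
injective on `[0,1)`. -/
def IsSimpleClosedCurve (O : Set Plane) : Prop :=
  ∃ f : ℝ → Plane, Continuous f ∧ Function.Periodic f 1 ∧
    Set.InjOn f (Set.Ico 0 1) ∧ f '' (Set.Ico 0 1) = O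

/-- The dendroid `X` is smooth at `p`: there is a choice `arcTo x` of the unique arc
from `x` to `p` (reduced to `{p}` for `x = p`) such that `xₙ → x` in `X` implies
`arcTo xₙ → arcTo x` in the Hausdorff distance. -/
def DendroidSmoothAt (X : Set Plane) (p : Plane) : Prop :=
  p ∈ X ∧ ∃ arcTo : Plane → Set Plane,
    arcTo p = {p} ∧
    (∀ x ∈ X, x ≠ p → arcTo x ⊆ X ∧ IsArcWithEndpoints (arcTo x) x p) ∧
    (∀ (xs : ℕ → Plane) (x : Plane), (∀ n, xs n ∈ X) → x ∈ X →
      Filter.Tendsto xs Filter.atTop (nhds x) →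
      Filter.Tendsto (fun n => EMetric.hausdorffEdist (arcTo (xs n)) (arcTo x))
        Filter.atTop (nhds 0))

/-- A space is zero-dimensional if it has a basis of clopen sets. -/
def IsZeroDimensionalSpace (β : Type*) [TopologicalSpace β] : Prop :=
  ∀ (x : β) (U : Set β), IsOpen U → x ∈ U → ∃ V : Set β, IsClopen V ∧ x ∈ V ∧ V ⊆ U

/-- A space is almost zero-dimensional if it has a neighborhood basis of sets
which are intersections of clopen sets. -/
def IsAlmostZeroDimensionalSpace (β : Type*) [TopologicalSpace β] : Prop :=
  ∀ (x : β) (U : Set β), IsOpen U → x ∈ U →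
    ∃ V : Set β, V ∈ nhds x ∧ V ⊆ U ∧
      ∃ 𝒞 : Set (Set β), (∀ C ∈ 𝒞, IsClopen C) ∧ V = ⋂₀ 𝒞

/-- The union of `W` with all of the bounded connected components of its complement. -/
def boundedComplementaryFill (W : Set Plane) : Set Plane :=
  W ∪ ⋃₀ {K | (∃ x ∈ Wᶜ, K = connectedComponentIn Wᶜ x) ∧ Bornology.IsBounded K}

/-- A Bellamy dendroid: a (non-degenerate) smooth plane dendroid whose endpoint
set is connected. -/
def IsBellamyDendroid (K : Set Plane) : Prop :=
  IsDendroid K ∧ K.Nontrivial ∧ (∃ q, DendroidSmoothAt K q) ∧ IsConnected (Endpoints K)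

/-- The middle-thirds Cantor set. -/
noncomputable def cantorC : Set ℝ :=
  {x | ∃ a : ℕ → Bool, x = ∑' i, (if a i then (2 : ℝ) else 0) / 3 ^ (i + 1)}

/-- `ℓ` is a continuous branch of the logarithm of `f` on `S`. -/
def IsLogOn {α : Type*} [TopologicalSpace α] (ℓ f : α → ℂ) (S : Set α) : Prop :=
  ContinuousOn ℓ S ∧ ∀ z ∈ S, Complex.exp (ℓ z) = f z

theorem IsLogOn.mono {α : Type*} [TopologicalSpace α] {ℓ f : α → ℂ} {S T : Set α}
    (h : IsLogOn ℓ f S) (hT : T ⊆ S) : IsLogOn ℓ f T :=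
  ⟨h.1.mono hT, fun z hz => h.2 z (hT hz)⟩

theorem exists_log_of_homotopy {Y : Type*} [TopologicalSpace Y] (H : C(unitInterval × Y, ℂ))
    (hH : ∀ q, H q ≠ 0) (f : C(Y, ℂ)) (hf : ∀ y, H (0, y) = Complex.exp (f y)) :
    ∃ g : C(Y, ℂ), ∀ y, Complex.exp (g y) = H (1, y) := by
  let H' : C(unitInterval × Y, {z : ℂ // z ≠ 0}) :=
    ⟨fun q => ⟨H q, hH q⟩, H.continuous.subtype_mk _⟩
  have h0 : ∀ y, H' (0, y) = (⟨Complex.exp (f y), Complex.exp_ne_zero _⟩ : {z : ℂ // z ≠ 0}) :=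
    fun y => Subtype.ext (hf y)
  let G := Complex.isCoveringMap_exp.liftHomotopy H' f h0
  have hG := Complex.isCoveringMap_exp.liftHomotopy_lifts H' f h0
  refine ⟨G.comp ⟨fun y => (1, y), by fun_prop⟩, fun y => ?_⟩
  exact congrArg Subtype.val (congrFun hG (1, y))

/-- A nonvanishing continuous function on a star-shaped set has a continuous logarithm. -/
theorem exists_isLogOn_of_starConvex {E : Type*} [AddCommGroup E] [Module ℝ E]
    [TopologicalSpace E] [ContinuousAdd E] [ContinuousSMul ℝ E] {S : Set E} {c : E} (hc : c ∈ S)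
    (hS : StarConvex ℝ c S) {f : E → ℂ} (hf : ContinuousOn f S) (h0 : ∀ z ∈ S, f z ≠ 0) :
    ∃ ℓ, IsLogOn ℓ f S := by
  classical
  have hmem : ∀ q : unitInterval × S, (1 - (q.1 : ℝ)) • c + (q.1 : ℝ) • (q.2 : E) ∈ S := by
    rintro ⟨⟨t, ht⟩, ⟨y, hy⟩⟩
    exact hS hy (by simpa using ht.2) ht.1 (by ring)
  let H : C(unitInterval × S, ℂ) := ⟨fun q => f ((1 - (q.1 : ℝ)) • c + (q.1 : ℝ) • (q.2 : E)),
    hf.comp_continuous (by fun_prop) hmem⟩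
  obtain ⟨g, hg⟩ := exists_log_of_homotopy H (fun q => h0 _ (hmem q))
    (ContinuousMap.const _ (Complex.log (f c))) (fun y => by
      simp [H, Complex.exp_log (h0 c hc)])
  refine ⟨fun z => if hz : z ∈ S then g ⟨z, hz⟩ else 0, ?_, fun z hz => ?_⟩
  · rw [continuousOn_iff_continuous_domRestrict]
    convert g.continuous using 1
    ext ⟨z, hz⟩
    simp [hz]
  · simpa [hz, H] using hg ⟨z, hz⟩

/-- Two continuous logarithms of the same function on a preconnected set differ by a constant. -/
theorem IsLogOn.sub_eq {α : Type*} [TopologicalSpace α] {ℓ₁ ℓ₂ f : α → ℂ} {S : Set α}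
    (h₁ : IsLogOn ℓ₁ f S) (h₂ : IsLogOn ℓ₂ f S) (hS : IsPreconnected S) {y z : α}
    (hy : y ∈ S) (hz : z ∈ S) : ℓ₁ y - ℓ₂ y = ℓ₁ z - ℓ₂ z := by
  have : DiscreteTopology (AddSubgroup.zmultiples (2 * Real.pi * Complex.I : ℂ)) :=
    NormedSpace.discreteTopology_zmultiples _
  refine hS.constant_of_mapsTo (hT := ⟨this⟩)
    (T := (AddSubgroup.zmultiples (2 * Real.pi * Complex.I : ℂ) : Set ℂ))
    (f := fun w => ℓ₁ w - ℓ₂ w) (hc := h₁.1.sub h₂.1) (hTm := ?_) (hx := hy) (hy := hz)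
  intro w hw
  have he : Complex.exp (ℓ₁ w) = Complex.exp (ℓ₂ w) := by rw [h₁.2 w hw, h₂.2 w hw]
  obtain ⟨n, hn⟩ := Complex.exp_eq_exp_iff_exists_int.1 he
  exact AddSubgroup.mem_zmultiples_iff.2 ⟨n, by simp [hn]⟩

/-- A logarithm on a closed set extends to a logarithm on a neighbourhood. -/
theorem IsLogOn.exists_open_extension {α : Type*} [TopologicalSpace α] [NormalSpace α]
    {ℓ f : α → ℂ} {K W : Set α} (h : IsLogOn ℓ f K) (hK : IsClosed K) (hW : IsOpen W)
    (hKW : K ⊆ W) (hf : ContinuousOn f W) :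
    ∃ U L, IsOpen U ∧ K ⊆ U ∧ U ⊆ W ∧ IsLogOn L f U ∧ EqOn L ℓ K := by
  obtain ⟨L, hL⟩ := ContinuousMap.exists_restrict_eq hK
    (⟨K.domRestrict ℓ, continuousOn_iff_continuous_domRestrict.1 h.1⟩ : C(K, ℂ))
  have hLK : ∀ z ∈ K, L z = ℓ z := fun z hz => congrArg (fun g : C(K, ℂ) => g ⟨z, hz⟩) hL
  let q : α → ℂ := fun z => f z * Complex.exp (-L z)
  have hq : ContinuousOn q W := hf.mul (by fun_prop)
  have hqK : ∀ z ∈ K, q z = 1 := fun z hz => by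
    simp only [q]
    rw [← h.2 z hz, hLK z hz, ← Complex.exp_add, add_neg_cancel, Complex.exp_zero]
  refine ⟨W ∩ q ⁻¹' Complex.slitPlane, fun z => L z + Complex.log (q z),
    hq.isOpen_inter_preimage hW Complex.isOpen_slitPlane, fun z hz => ⟨hKW hz, ?_⟩,
    inter_subset_left, ⟨?_, fun z hz => ?_⟩, fun z hz => ?_⟩
  · rw [mem_preimage, hqK z hz]; exact Complex.one_mem_slitPlane
  · exact L.continuous.continuousOn.add
      ((hq.mono inter_subset_left).clog fun z hz => hz.2)
  · rw [Complex.exp_add, Complex.exp_log (Complex.slitPlane_ne_zero hz.2)]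
    simp only [q]
    rw [mul_comm (f z), ← mul_assoc, ← Complex.exp_add, add_neg_cancel, Complex.exp_zero, one_mul]
  · simp [hqK z hz, hLK z hz]

/-- A nonvanishing continuous function on an arc has a continuous logarithm. -/
theorem IsArcWithEndpoints.exists_isLogOn {α : Type*} [TopologicalSpace α] [T2Space α]
    {A : Set α} {a b : α} (hA : IsArcWithEndpoints A a b) {f : α → ℂ} (hf : ContinuousOn f A)
    (h0 : ∀ z ∈ A, f z ≠ 0) : ∃ ℓ, IsLogOn ℓ f A := by
  obtain ⟨k, hk, hinj, rfl, -, -⟩ := hA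
  obtain ⟨ℓ, hℓ, hℓe⟩ := exists_isLogOn_of_starConvex (c := (0 : ℝ)) (S := Icc 0 1) (by simp)
    ((convex_Icc 0 1).starConvex (by simp)) (hf.comp hk (mapsTo_image _ _))
    (fun z hz => h0 _ (mem_image_of_mem _ hz))
  refine ⟨fun z => ℓ (Function.invFunOn k (Icc 0 1) z), ?_, ?_⟩
  · refine hℓ.comp ?_ ?_
    · rw [continuousOn_iff_isClosed]
      intro t ht
      refine ⟨k '' (t ∩ Icc 0 1), ?_, ?_⟩
      · exact ((isCompact_Icc.inter_left ht).image_of_continuousOn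
          (hk.mono inter_subset_right)).isClosed
      · ext z
        constructor
        · rintro ⟨h1, y, hy, rfl⟩
          rw [mem_preimage, hinj.leftInvOn_invFunOn hy] at h1
          exact ⟨⟨y, ⟨h1, hy⟩, rfl⟩, y, hy, rfl⟩
        · rintro ⟨⟨y, ⟨hy1, hy⟩, rfl⟩, h⟩
          refine ⟨?_, h⟩
          rwa [mem_preimage, hinj.leftInvOn_invFunOn hy]
    · rintro _ ⟨y, hy, rfl⟩
      rwa [hinj.leftInvOn_invFunOn hy]
  · rintro _ ⟨y, hy, rfl⟩
    simp only [hinj.leftInvOn_invFunOn hy]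
    exact hℓe y hy

/-- The standard isometry from the plane to `ℂ`. -/
noncomputable def planeToComplex : Plane ≃ₗᵢ[ℝ] ℂ := Complex.orthonormalBasisOneI.repr.symm

/-- The quotient `(z - e) / (z - x)`, as a complex-valued function on the plane. -/
noncomputable def ratioMap (e x z : Plane) : ℂ := planeToComplex (z - e) / planeToComplex (z - x)

theorem planeToComplex_sub_ne_zero {z w : Plane} (h : z ≠ w) : planeToComplex (z - w) ≠ 0 := by
  simpa [sub_eq_zero] using h

theorem continuousOn_ratioMap (e x : Plane) : ContinuousOn (ratioMap e x) {x}ᶜ :=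
  ContinuousOn.div (by fun_prop) (by fun_prop) fun _ hz => planeToComplex_sub_ne_zero hz

theorem ratioMap_ne_zero {e x z : Plane} (he : z ≠ e) (hx : z ≠ x) : ratioMap e x z ≠ 0 :=
  div_ne_zero (planeToComplex_sub_ne_zero he) (planeToComplex_sub_ne_zero hx)

/-- Off a path joining `e` to `x`, the function `(z - e) / (z - x)` has a logarithm. -/
theorem exists_isLogOn_ratioMap {e x : Plane} (γ : Path x e) :
    ∃ ℓ, IsLogOn ℓ (ratioMap e x) (range γ)ᶜ := by
  classical
  have hne : ∀ (t : unitInterval) (y : ((range γ)ᶜ : Set Plane)), (y : Plane) ≠ γ t :=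
    fun t y h => y.2 ⟨t, h.symm⟩
  have hnx : ∀ y : ((range γ)ᶜ : Set Plane), (y : Plane) ≠ x := fun y h =>
    hne 0 y (by simpa using h)
  let H : C(unitInterval × ((range γ)ᶜ : Set Plane), ℂ) :=
    ⟨fun q => planeToComplex (q.2 - γ q.1) / planeToComplex (q.2 - x),
      Continuous.div (by fun_prop) (by fun_prop) fun q => planeToComplex_sub_ne_zero (hnx _)⟩
  obtain ⟨g, hg⟩ := exists_log_of_homotopy H
    (fun q => div_ne_zero (planeToComplex_sub_ne_zero (hne _ _)) (planeToComplex_sub_ne_zero (hnx _)))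
    (ContinuousMap.const _ 0) (fun y => by
      simp only [H, ContinuousMap.coe_mk, ContinuousMap.const_apply, Complex.exp_zero, Path.source]
      exact div_self (planeToComplex_sub_ne_zero (hnx y)))
  refine ⟨fun z => if hz : z ∈ (range γ)ᶜ then g ⟨z, hz⟩ else 0, ?_, fun z hz => ?_⟩
  · rw [continuousOn_iff_continuous_domRestrict]
    convert g.continuous using 1
    ext ⟨z, hz⟩
    rw [domRestrict_apply, dif_pos hz]
  · simp only [dif_pos hz, hg]
    simp [H, ratioMap]

/-- `z - w` has no continuous logarithm on a circle centred at `w`. -/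
theorem not_isLogOn_sphere (w : Plane) {r : ℝ} (hr : 0 < r) (ℓ : Plane → ℂ) :
    ¬ IsLogOn ℓ (fun z => planeToComplex (z - w)) (Metric.sphere w r) := by
  intro h
  let k : ℝ → Plane := fun θ => w + planeToComplex.symm (r * Complex.exp (θ * Complex.I))
  have hk : Continuous k := by fun_prop
  have hks : ∀ θ, k θ ∈ Metric.sphere w r := fun θ => by
    simp [k, abs_of_pos hr]
  have h1 : IsLogOn (fun θ => ℓ (k θ)) (fun θ : ℝ => (r * Complex.exp (θ * Complex.I) : ℂ)) univ :=
    ⟨(h.1.comp_continuous hk hks).continuousOn, fun θ _ => by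
      rw [h.2 _ (hks θ)]; simp [k]⟩
  have h2 : IsLogOn (fun θ : ℝ => (Real.log r + θ * Complex.I : ℂ))
      (fun θ : ℝ => (r * Complex.exp (θ * Complex.I) : ℂ)) univ :=
    ⟨by fun_prop, fun θ _ => by
      rw [Complex.exp_add, ← Complex.ofReal_exp, Real.exp_log hr]⟩
  have h3 := h1.sub_eq h2 isPreconnected_univ (mem_univ 0) (mem_univ (2 * Real.pi))
  have h4 : k (2 * Real.pi) = k 0 := by simp [k, Complex.exp_two_pi_mul_I]
  simp only [h4] at h3
  have h5 := congrArg (fun t => ℓ (k 0) - Real.log r - t) h3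
  push_cast at h5
  ring_nf at h5
  simp at h5

/-- `(z - e) / (z - x)` has no logarithm on a circle around `e` that does not enclose `x`. -/
theorem not_isLogOn_ratioMap_sphere {e x : Plane} {r : ℝ} (hr : 0 < r) (hx : r < dist x e)
    (ℓ : Plane → ℂ) : ¬ IsLogOn ℓ (ratioMap e x) (Metric.sphere e r) := by
  intro h
  have hne : ∀ z ∈ Metric.closedBall e r, z ≠ x := by
    rintro z hz rfl
    exact absurd (Metric.mem_closedBall.1 hz) (not_le.2 hx)
  obtain ⟨m, hm⟩ := exists_isLogOn_of_starConvex (c := e) (S := Metric.closedBall e r)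
    (Metric.mem_closedBall_self hr.le)
    ((convex_closedBall e r).starConvex (Metric.mem_closedBall_self hr.le))
    (f := fun z => planeToComplex (z - x)) (by fun_prop)
    (fun z hz => planeToComplex_sub_ne_zero (hne z hz))
  refine not_isLogOn_sphere e hr (fun z => ℓ z + m z)
    ⟨h.1.add (hm.1.mono Metric.sphere_subset_closedBall), fun z hz => ?_⟩
  have hz' := Metric.sphere_subset_closedBall hz
  rw [Complex.exp_add, h.2 z hz, hm.2 z hz', ratioMap,
    div_mul_cancel₀ _ (planeToComplex_sub_ne_zero (hne z hz'))]

section Arcs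

variable {α : Type*} [TopologicalSpace α]

theorem isArcWithEndpoints_image_Icc {k : ℝ → α} {s t : ℝ} (hst : s < t)
    (hk : ContinuousOn k (Icc s t)) (hinj : InjOn k (Icc s t)) :
    IsArcWithEndpoints (k '' Icc s t) (k s) (k t) := by
  have hd : 0 < t - s := sub_pos.2 hst
  have himg : (fun r : ℝ => s + (t - s) * r) '' Icc 0 1 = Icc s t := by
    ext y
    constructor
    · rintro ⟨r, ⟨h0, h1⟩, rfl⟩
      constructor <;> dsimp only <;> nlinarith
    · rintro ⟨h0, h1⟩
      refine ⟨(y - s) / (t - s), ⟨by apply div_nonneg <;> linarith,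
        (div_le_one hd).2 (by linarith)⟩, ?_⟩
      field_simp
      ring
  have hmaps : MapsTo (fun r : ℝ => s + (t - s) * r) (Icc 0 1) (Icc s t) := himg ▸ mapsTo_image _ _
  refine ⟨fun r => k (s + (t - s) * r), hk.comp (by fun_prop) hmaps, ?_, ?_, by simp, by simp⟩
  · refine hinj.comp ?_ hmaps
    intro a _ b _ hab
    have : (t - s) * a = (t - s) * b := by simpa using hab
    exact mul_left_cancel₀ hd.ne' this
  · rw [← himg, image_image]

namespace IsArcWithEndpoints

variable {A B : Set α} {a b c d : α}

theorem isCompact (hA : IsArcWithEndpoints A a b) : IsCompact A := by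
  obtain ⟨k, hk, -, rfl, -, -⟩ := hA
  exact isCompact_Icc.image_of_continuousOn hk

theorem left_mem (hA : IsArcWithEndpoints A a b) : a ∈ A := by
  obtain ⟨k, -, -, rfl, rfl, -⟩ := hA
  exact ⟨0, by simp, rfl⟩

theorem right_mem (hA : IsArcWithEndpoints A a b) : b ∈ A := by
  obtain ⟨k, -, -, rfl, -, rfl⟩ := hA
  exact ⟨1, by simp, rfl⟩

theorem isConnected (hA : IsArcWithEndpoints A a b) : IsConnected A := by
  refine ⟨⟨a, hA.left_mem⟩, ?_⟩
  obtain ⟨k, hk, -, rfl, -, -⟩ := hA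
  exact isPreconnected_Icc.image _ hk

theorem ne (hA : IsArcWithEndpoints A a b) : a ≠ b := by
  obtain ⟨k, -, hinj, -, rfl, rfl⟩ := hA
  intro h
  exact zero_ne_one (hinj (by simp) (by simp) h)

theorem symm (hA : IsArcWithEndpoints A a b) : IsArcWithEndpoints A b a := by
  obtain ⟨k, hk, hinj, rfl, rfl, rfl⟩ := hA
  have himg : (fun r : ℝ => 1 - r) '' Icc 0 1 = Icc 0 1 := by simp
  have hmaps : MapsTo (fun r : ℝ => 1 - r) (Icc 0 1) (Icc 0 1) := fun r hr =>
    ⟨sub_nonneg.2 hr.2, sub_le_self _ hr.1⟩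
  refine ⟨fun r => k (1 - r), hk.comp (by fun_prop) hmaps,
    hinj.comp (fun _ _ _ _ h => by simpa using h) hmaps, ?_, by simp, by simp⟩
  conv_rhs => rw [← himg, image_image]

/-- The path running along an arc. -/
theorem exists_path (hA : IsArcWithEndpoints A a b) : ∃ γ : Path a b, range γ = A := by
  obtain ⟨k, hk, -, rfl, rfl, rfl⟩ := hA
  refine ⟨⟨⟨(Icc 0 1).domRestrict k, continuousOn_iff_continuous_domRestrict.1 hk⟩, rfl, rfl⟩, ?_⟩
  exact range_domRestrict k _

/-- A connected subset of an arc containing both its ends is the whole arc. -/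
theorem subset_of_isPreconnected [T2Space α] (hA : IsArcWithEndpoints A a b) {S : Set α}
    (hS : IsPreconnected S) (hSA : S ⊆ A) (ha : a ∈ S) (hb : b ∈ S) : A ⊆ S := by
  obtain ⟨k, hk, hinj, rfl, rfl, rfl⟩ := hA
  rintro _ ⟨s, hs, rfl⟩
  have h1 : IsClosed (k '' Icc 0 s) :=
    (isCompact_Icc.image_of_continuousOn (hk.mono (Icc_subset_Icc_right hs.2))).isClosed
  have h2 : IsClosed (k '' Icc s 1) :=
    (isCompact_Icc.image_of_continuousOn (hk.mono (Icc_subset_Icc_left hs.1))).isClosed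
  obtain ⟨z, hz, ⟨r, hr, rfl⟩, ⟨q, hq, hqr⟩⟩ := isPreconnected_closed_iff.1 hS _ _ h1 h2
    (by rw [← image_union, Icc_union_Icc_eq_Icc hs.1 hs.2]; exact hSA)
    ⟨_, ha, ⟨0, ⟨le_rfl, hs.1⟩, rfl⟩⟩ ⟨_, hb, ⟨1, ⟨hs.2, le_rfl⟩, rfl⟩⟩
  have hqr' : q = r := hinj ⟨hs.1.trans hq.1, hq.2⟩ ⟨hr.1, hr.2.trans hs.2⟩ hqr
  subst hqr'
  rwa [le_antisymm hr.2 hq.1] at hz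

theorem isPreconnected_diff_singleton_left (hA : IsArcWithEndpoints A a b) :
    IsPreconnected (A \ {a}) := by
  obtain ⟨k, hk, hinj, rfl, rfl, rfl⟩ := hA
  have : k '' Icc 0 1 \ {k 0} = k '' Ioc 0 1 := by
    rw [← image_singleton, ← hinj.image_sdiff_subset (by simp)]
    simp
  rw [this]
  exact isPreconnected_Ioc.image _ (hk.mono Ioc_subset_Icc_self)

theorem isPreconnected_diff_pair (hA : IsArcWithEndpoints A a b) :
    IsPreconnected (A \ {a, b}) ∧ a ∈ closure (A \ {a, b}) := by
  obtain ⟨k, hk, hinj, rfl, rfl, rfl⟩ := hA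
  have : k '' Icc 0 1 \ {k 0, k 1} = k '' Ioo 0 1 := by
    rw [← image_pair, ← hinj.image_sdiff_subset (by simp [pair_subset_iff])]
    simp
  rw [this]
  refine ⟨isPreconnected_Ioo.image _ (hk.mono Ioo_subset_Icc_self), ?_⟩
  refine ContinuousWithinAt.mem_closure_image
    ((hk 0 (by simp)).mono Ioo_subset_Icc_self) ?_
  rw [closure_Ioo zero_ne_one]
  simp

theorem eq_or_eq_of_left [T2Space α] (hA : IsArcWithEndpoints A a b)
    (hA' : IsArcWithEndpoints A c d) : c = a ∨ c = b := by
  by_contra! h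
  have := hA.subset_of_isPreconnected hA'.isPreconnected_diff_singleton_left sdiff_subset
    ⟨hA.left_mem, fun h' => h.1 h'.symm⟩ ⟨hA.right_mem, fun h' => h.2 h'.symm⟩ hA'.left_mem
  exact this.2 rfl

/-- An end of `X` lying on an arc in `X` is an end of this arc. -/
theorem eq_or_eq_of_mem_endpoints [T2Space α] {X : Set α} (hA : IsArcWithEndpoints A a b)
    (hAX : A ⊆ X) (hc : c ∈ Endpoints X) (hcA : c ∈ A) : c = a ∨ c = b := by
  obtain ⟨d, hd⟩ := hc.2 A hAX ⟨a, b, hA⟩ hcA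
  exact hA.eq_or_eq_of_left hd

/-- The part of an arc beyond one of its points. -/
theorem exists_subarc (hA : IsArcWithEndpoints A a b) (hc : c ∈ A) (hcb : c ≠ b) :
    ∃ B ⊆ A, IsArcWithEndpoints B c b ∧ (c ≠ a → a ∉ B) := by
  obtain ⟨k, hk, hinj, rfl, rfl, rfl⟩ := hA
  obtain ⟨s, hs, rfl⟩ := hc
  have hs1 : s < 1 := lt_of_le_of_ne hs.2 (by rintro rfl; exact hcb rfl)
  have hsub : Icc s 1 ⊆ Icc 0 1 := Icc_subset_Icc_left hs.1
  refine ⟨k '' Icc s 1, image_mono hsub,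
    isArcWithEndpoints_image_Icc hs1 (hk.mono hsub) (hinj.mono hsub), ?_⟩
  rintro hne ⟨r, hr, h⟩
  have := hinj (hsub hr) (by simp) h
  subst this
  exact hne (by rw [le_antisymm hr.1 hs.1])

theorem union (hA : IsArcWithEndpoints A a b) (hB : IsArcWithEndpoints B b c)
    (hAB : A ∩ B ⊆ {b}) : IsArcWithEndpoints (A ∪ B) a c := by
  obtain ⟨f, hf, hfi, rfl, rfl, rfl⟩ := hA
  obtain ⟨g, hg, hgi, rfl, hg0, rfl⟩ := hB
  let k : ℝ → α := fun r => if r ≤ 1 then f r else g (r - 1)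
  have hk1 : EqOn k f (Icc 0 1) := fun r hr => if_pos hr.2
  have hk2 : EqOn k (fun r => g (r - 1)) (Icc 1 2) := fun r hr => by
    by_cases h : r ≤ 1
    · have : r = 1 := le_antisymm h hr.1
      subst this
      simp [k, hg0]
    · simp [k, h]
  have hm : MapsTo (fun r : ℝ => r - 1) (Icc 1 2) (Icc 0 1) := fun r hr =>
    ⟨by linarith [hr.1], by linarith [hr.2]⟩
  have hu : Icc (0 : ℝ) 2 = Icc 0 1 ∪ Icc 1 2 :=
    (Icc_union_Icc_eq_Icc zero_le_one one_le_two).symm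
  have hkc : ContinuousOn k (Icc 0 2) := by
    rw [hu]
    exact (hf.congr hk1).union_of_isClosed
      ((hg.comp (by fun_prop) hm).congr hk2) isClosed_Icc isClosed_Icc
  have key : ∀ r ∈ Icc (0 : ℝ) 1, ∀ s ∈ Icc (1 : ℝ) 2, k r = k s → r = s := by
    intro r hr s hs h
    rw [hk1 hr, hk2 hs] at h
    dsimp only at h
    have h1 : f r = f 1 := hAB ⟨⟨r, hr, rfl⟩, ⟨s - 1, hm hs, h.symm⟩⟩
    have h2 : r = 1 := hfi hr (by simp) h1
    have h3 : g (s - 1) = g 0 := by rw [← h, h1, hg0]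
    have h4 : s - 1 = 0 := hgi (hm hs) (by simp) h3
    linarith
  have hki : InjOn k (Icc 0 2) := by
    intro r hr s hs h
    rw [hu] at hr hs
    rcases hr with hr | hr <;> rcases hs with hs | hs
    · rw [hk1 hr, hk1 hs] at h; exact hfi hr hs h
    · exact key r hr s hs h
    · exact (key s hs r hr h.symm).symm
    · rw [hk2 hr, hk2 hs] at h
      have := hgi (hm hr) (hm hs) h
      linarith
  have h := isArcWithEndpoints_image_Icc two_pos hkc hki
  have h0 : k 0 = f 0 := hk1 (by simp)
  have h2 : k 2 = g 1 := by rw [hk2 (by simp)]; norm_num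
  have himg : (fun r : ℝ => g (r - 1)) '' Icc 1 2 = g '' Icc 0 1 := by
    rw [← image_image g (fun r : ℝ => r - 1), image_sub_const_Icc]
    norm_num
  rwa [h0, h2, hu, image_union, hk1.image_eq, hk2.image_eq, himg] at h

/-- Two consecutive arcs contain an arc joining the first point to the last one. -/
theorem exists_subset_union [T2Space α] (hA : IsArcWithEndpoints A a b)
    (hB : IsArcWithEndpoints B b c) (hac : a ≠ c) :
    ∃ C ⊆ A ∪ B, IsArcWithEndpoints C a c := by
  by_cases haB : a ∈ B
  · obtain ⟨C, hC, h, -⟩ := hB.exists_subarc haB hac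
    exact ⟨C, hC.trans subset_union_right, h⟩
  have hBc := hB.isCompact.isClosed
  have hbB := hB.left_mem
  obtain ⟨f, hf, hfi, rfl, rfl, rfl⟩ := hA
  have hT : IsCompact (Icc 0 1 ∩ f ⁻¹' B) :=
    isCompact_Icc.of_isClosed_subset (hf.preimage_isClosed_of_isClosed isClosed_Icc hBc)
      inter_subset_left
  obtain ⟨s, ⟨hs, hsB⟩, hmin⟩ := hT.exists_isLeast ⟨1, by simp, hbB⟩
  have hs0 : 0 < s := lt_of_le_of_ne hs.1 (by rintro rfl; exact haB hsB)
  have hsub : Icc 0 s ⊆ Icc 0 1 := Icc_subset_Icc_right hs.2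
  have hfs := isArcWithEndpoints_image_Icc hs0 (hf.mono hsub) (hfi.mono hsub)
  by_cases hsc : f s = c
  · exact ⟨_, (image_mono hsub).trans subset_union_left, hsc ▸ hfs⟩
  obtain ⟨C, hC, hC', -⟩ := hB.exists_subarc hsB hsc
  refine ⟨_, union_subset_union (image_mono hsub) hC, hfs.union hC' ?_⟩
  rintro _ ⟨⟨r, hr, rfl⟩, hrC⟩
  have : s ≤ r := hmin ⟨hsub hr, hC hrC⟩
  rw [le_antisymm hr.2 this]
  rfl

end IsArcWithEndpoints

/-- In a hereditarily unicoherent set, arcs are determined by their ends. -/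
theorem HereditarilyUnicoherent.arc_subset [T2Space α] {X A B : Set α} {a b : α}
    (hX : HereditarilyUnicoherent X) (hAX : A ⊆ X) (hBX : B ⊆ X) (hA : IsArcWithEndpoints A a b)
    (hB : IsArcWithEndpoints B a b) : A ⊆ B := fun _ hz =>
  (hA.subset_of_isPreconnected
    (hX A B hAX hBX hA.isCompact hA.isConnected hB.isCompact hB.isConnected) inter_subset_left
    ⟨hA.left_mem, hB.left_mem⟩ ⟨hA.right_mem, hB.right_mem⟩ hz).2

end Arcs

theorem isArcWithEndpoints_segment {E : Type*} [AddCommGroup E] [Module ℝ E] [TopologicalSpace E]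
    [ContinuousAdd E] [ContinuousSMul ℝ E] {a b : E} (hab : a ≠ b) :
    IsArcWithEndpoints (segment ℝ a b) a b := by
  refine ⟨AffineMap.lineMap a b, ?_, (AffineMap.lineMap_injective ℝ hab).injOn,
    (segment_eq_image_lineMap ℝ a b).symm, by simp, by simp⟩
  have h : ⇑(AffineMap.lineMap (k := ℝ) a b) = fun t : ℝ => (1 - t) • a + t • b :=
    funext fun t => AffineMap.lineMap_apply_module a b t
  rw [h]
  fun_prop

/-- Two points of a connected open set in a normed space are joined by an arc in this set. -/
theorem IsPreconnected.exists_arc {E : Type*} [NormedAddCommGroup E] [NormedSpace ℝ E]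
    {U : Set E} (hc : IsPreconnected U) (hU : IsOpen U) {a b : E} (ha : a ∈ U) (hb : b ∈ U)
    (hab : a ≠ b) : ∃ A ⊆ U, IsArcWithEndpoints A a b := by
  refine (hc.induction₂ (fun a b => a = b ∨ ∃ A ⊆ U, IsArcWithEndpoints A a b) ?_ ?_ ?_
    ha hb).resolve_left hab
  · intro x hx
    obtain ⟨ε, hε, hball⟩ := Metric.isOpen_iff.1 hU x hx
    filter_upwards [mem_nhdsWithin_of_mem_nhds (Metric.ball_mem_nhds x hε)] with y hy
    by_cases hxy : x = y
    · exact Or.inl hxy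
    · exact Or.inr ⟨_, ((convex_ball x ε).segment_subset (Metric.mem_ball_self hε) hy).trans hball,
        isArcWithEndpoints_segment hxy⟩
  · rintro x y z _ _ _ (rfl | ⟨A, hA, hA'⟩) (rfl | ⟨B, hB, hB'⟩)
    · exact Or.inl rfl
    · exact Or.inr ⟨B, hB, hB'⟩
    · exact Or.inr ⟨A, hA, hA'⟩
    · by_cases hxz : x = z
      · exact Or.inl hxz
      · obtain ⟨C, hC, hC'⟩ := hA'.exists_subset_union hB' hxz
        exact Or.inr ⟨C, hC.trans (union_subset hA hB), hC'⟩
  · rintro x y _ _ (rfl | ⟨A, hA, hA'⟩)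
    · exact Or.inl rfl
    · exact Or.inr ⟨A, hA, hA'.symm⟩

/-- Two arcs in the plane with the same ends and no other common point form a simple closed
curve. -/
theorem IsArcWithEndpoints.isSimpleClosedCurve_union {A B : Set Plane} {a b : Plane}
    (hA : IsArcWithEndpoints A a b) (hB : IsArcWithEndpoints B a b) (hAB : A ∩ B ⊆ {a, b}) :
    IsSimpleClosedCurve (A ∪ B) := by
  replace hB := hB.symm
  obtain ⟨f, hf, hfi, rfl, rfl, rfl⟩ := hA
  obtain ⟨g, hg, hgi, rfl, hg0, hg1⟩ := hB
  let k : ℝ → Plane := fun r => if r ≤ 1 / 2 then f (2 * r) else g (2 * r - 1)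
  have hm1 : MapsTo (fun r : ℝ => 2 * r) (Icc 0 (1 / 2)) (Icc 0 1) := fun r hr =>
    ⟨by linarith [hr.1], by linarith [hr.2]⟩
  have hm2 : MapsTo (fun r : ℝ => 2 * r - 1) (Icc (1 / 2) 1) (Icc 0 1) := fun r hr =>
    ⟨by linarith [hr.1], by linarith [hr.2]⟩
  have hk1 : EqOn k (fun r => f (2 * r)) (Icc 0 (1 / 2)) := fun r hr => if_pos hr.2
  have hk2 : EqOn k (fun r => g (2 * r - 1)) (Icc (1 / 2) 1) := fun r hr => by
    by_cases h : r ≤ 1 / 2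
    · have : r = 1 / 2 := le_antisymm h hr.1
      subst this
      simp [k, hg0]
    · simp only [k, if_neg h]
  have hu : Icc (0 : ℝ) 1 = Icc 0 (1 / 2) ∪ Icc (1 / 2) 1 :=
    (Icc_union_Icc_eq_Icc (by norm_num) (by norm_num)).symm
  have hkc : ContinuousOn k (Icc 0 1) := by
    rw [hu]
    exact ((hf.comp (by fun_prop) hm1).congr hk1).union_of_isClosed
      ((hg.comp (by fun_prop) hm2).congr hk2) isClosed_Icc isClosed_Icc
  have h01 : k 0 = k 1 := by
    rw [hk1 (by simp), hk2 (by constructor <;> norm_num)]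
    norm_num [hg1]
  have himg : k '' Icc 0 1 = f '' Icc 0 1 ∪ g '' Icc 0 1 := by
    rw [hu, image_union, hk1.image_eq, hk2.image_eq]
    congr 1
    · rw [← image_image f (fun r : ℝ => 2 * r), image_mul_left_Icc (by norm_num) (by norm_num)]
      norm_num
    · rw [← image_image g (fun r : ℝ => 2 * r - 1)]
      congr 1
      rw [← image_image (fun r : ℝ => r - 1) (fun r : ℝ => 2 * r),
        image_mul_left_Icc (by norm_num) (by norm_num), image_sub_const_Icc]
      norm_num
  have key : ∀ r ∈ Icc (0 : ℝ) (1 / 2), ∀ s ∈ Icc (1 / 2 : ℝ) 1, s < 1 → k r = k s → r = s := by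
    intro r hr s hs hs1 h
    rw [hk1 hr, hk2 hs] at h
    dsimp only at h
    rcases hAB ⟨⟨2 * r, hm1 hr, rfl⟩, ⟨2 * s - 1, hm2 hs, h.symm⟩⟩ with h1 | h1
    · have h3 : g (2 * s - 1) = g 1 := by rw [← h, h1, hg1]
      have := hgi (hm2 hs) (by simp) h3
      linarith
    · have h2 := hfi (hm1 hr) (by simp) h1
      have h3 : g (2 * s - 1) = g 0 := by rw [← h, h1, hg0]
      have := hgi (hm2 hs) (by simp) h3
      linarith
  have hki : InjOn k (Ico 0 1) := by
    intro r hr s hs h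
    have hr' := Ico_subset_Icc_self hr
    have hs' := Ico_subset_Icc_self hs
    rw [hu] at hr' hs'
    rcases hr' with hr' | hr' <;> rcases hs' with hs' | hs'
    · rw [hk1 hr', hk1 hs'] at h
      have := hfi (hm1 hr') (hm1 hs') h
      linarith
    · exact key r hr' s hs' hs.2 h
    · exact (key s hs' r hr' hr.2 h.symm).symm
    · rw [hk2 hr', hk2 hs'] at h
      have := hgi (hm2 hr') (hm2 hs') h
      linarith
  have : Fact (0 < (1 : ℝ)) := ⟨one_pos⟩
  have hlift : ∀ r ∈ Ico (0 : ℝ) 1, AddCircle.liftIco 1 0 k (r : AddCircle (1 : ℝ)) = k r :=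
    fun r hr => AddCircle.liftIco_zero_coe_apply hr
  refine ⟨fun r => AddCircle.liftIco 1 0 k (r : AddCircle (1 : ℝ)),
    (AddCircle.liftIco_zero_continuous h01 hkc).comp (AddCircle.continuous_mk' 1), ?_, ?_, ?_⟩
  · intro r
    simp only [AddCircle.coe_add, AddCircle.coe_period, add_zero]
  · exact hki.congr (fun r hr => (hlift r hr).symm)
  · rw [image_congr hlift, ← himg]
    refine (image_mono Ico_subset_Icc_self).antisymm ?_
    rintro _ ⟨r, hr, rfl⟩
    rcases hr.2.lt_or_eq with h | rfl
    · exact ⟨r, ⟨hr.1, h⟩, rfl⟩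
    · exact ⟨0, by simp, h01⟩

theorem one_lt_rank_plane : 1 < Module.rank ℝ Plane :=
  Module.one_lt_rank_of_one_lt_finrank (by simp)

theorem isPreconnected_ball_diff_singleton (t c : Plane) {r : ℝ} (hr : 0 < r) :
    IsPreconnected (Metric.ball t r \ {c}) := by
  by_cases hc : c ∈ Metric.ball t r
  · let φ := OpenPartialHomeomorph.univBall t r
    have hs : φ.source = univ := OpenPartialHomeomorph.univBall_source t r
    have ht : φ.target = Metric.ball t r := OpenPartialHomeomorph.univBall_target t hr
    have : Metric.ball t r \ {c} = φ '' {φ.symm c}ᶜ := by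
      ext z
      constructor
      · rintro ⟨hz, hzc⟩
        refine ⟨φ.symm z, fun h => hzc ?_, φ.right_inv (ht ▸ hz)⟩
        exact φ.symm.injOn (by simpa [ht] using hz) (by simpa [ht] using hc) h
      · rintro ⟨y, hy, rfl⟩
        refine ⟨ht ▸ φ.map_source (hs ▸ mem_univ y), fun h => hy ?_⟩
        rw [mem_singleton_iff] at h ⊢
        rw [← h, φ.left_inv (hs ▸ mem_univ y)]
    rw [this]
    exact (isConnected_compl_singleton_of_one_lt_rank one_lt_rank_plane _).isPreconnected.image _
      (φ.continuousOn.mono (by simp [hs]))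
  · rw [sdiff_singleton_eq_self hc]
    exact (convex_ball t r).isPreconnected

/-- A hereditarily unicoherent plane set contains no disc. -/
theorem HereditarilyUnicoherent.interior_eq_empty {X : Set Plane}
    (hX : HereditarilyUnicoherent X) : interior X = ∅ := by
  rw [eq_empty_iff_forall_notMem]
  intro c hc
  obtain ⟨r, hr, hball⟩ := Metric.isOpen_iff.1 isOpen_interior c hc
  replace hball := hball.trans interior_subset
  let q : ℝ := r / 2
  have hq : 0 < q := half_pos hr
  have hqr : q < r := half_lt_self hr
  let u : Plane := c - EuclideanSpace.single 0 q
  let v : Plane := c + EuclideanSpace.single 0 q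
  let w : Plane := c + EuclideanSpace.single 1 q
  have hu : u ∈ Metric.ball c r := by simpa [u, abs_of_pos hq] using hqr
  have hv : v ∈ Metric.ball c r := by simpa [v, abs_of_pos hq] using hqr
  have hw : w ∈ Metric.ball c r := by simpa [w, abs_of_pos hq] using hqr
  have huv : u ≠ v := fun h => by
    have := congrArg (fun z : Plane => z 0) h
    simp [u, v] at this
    linarith
  have huw : u ≠ w := fun h => by
    have := congrArg (fun z : Plane => z 1) h
    simp [u, w] at this
    linarith
  have hwv : w ≠ v := fun h => by
    have := congrArg (fun z : Plane => z 1) h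
    simp [v, w] at this
    linarith
  have hseg : ∀ {y z : Plane}, y ∈ Metric.ball c r → z ∈ Metric.ball c r → segment ℝ y z ⊆ X :=
    fun hy hz => ((convex_ball c r).segment_subset hy hz).trans hball
  obtain ⟨C, hC, hC'⟩ := (isArcWithEndpoints_segment huw).exists_subset_union
    (isArcWithEndpoints_segment hwv) huv
  have hsub := hX.arc_subset (hseg hu hv) (hC.trans (union_subset (hseg hu hw) (hseg hw hv)))
    (isArcWithEndpoints_segment huv) hC'
  have hcm : c ∈ segment ℝ u v := by
    refine ⟨1 / 2, 1 / 2, by norm_num, by norm_num, by norm_num, ?_⟩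
    simp only [u, v]
    module
  rcases hC (hsub hcm) with ⟨a, b, -, -, hab, h⟩ | ⟨a, b, -, -, hab, h⟩
  · have h0 := congrArg (fun z : Plane => z 0) h
    have h1 := congrArg (fun z : Plane => z 1) h
    simp [u, w] at h0 h1
    have : (a + b) * q = 0 := by linear_combination -h0 + h1 + (c 0 - c 1) * hab
    rw [hab] at this
    linarith
  · have h0 := congrArg (fun z : Plane => z 0) h
    have h1 := congrArg (fun z : Plane => z 1) h
    simp [v, w] at h0 h1
    have : (a + b) * q = 0 := by linear_combination h0 + h1 - (c 0 + c 1) * hab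
    rw [hab] at this
    linarith

/-- A point outside a compact set is joined to the set by a segment meeting it only at a nearest
point. -/
theorem IsCompact.exists_nearest_segment {E : Type*} [NormedAddCommGroup E] [NormedSpace ℝ E]
    {X : Set E} (hX : IsCompact X) (hne : X.Nonempty) (a : E) :
    ∃ a' ∈ X, (∀ y ∈ X, dist a a' ≤ dist a y) ∧ segment ℝ a' a ∩ X ⊆ {a'} := by
  obtain ⟨a', ha', hmin⟩ := hX.exists_isMinOn hne
    (f := fun y => dist a y) (by fun_prop)
  refine ⟨a', ha', fun y hy => hmin hy, ?_⟩
  rintro z ⟨hz, hzX⟩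
  have h1 := dist_add_dist_of_mem_segment hz
  have h2 : dist a a' ≤ dist a z := hmin hzX
  rw [dist_comm a a', dist_comm a z] at h2
  have h3 : dist a' z ≤ 0 := by linarith
  exact (dist_le_zero.1 h3).symm

/-- Convergence in Hausdorff distance implies upper semicontinuity. -/
theorem eventually_subset_of_tendsto_hausdorffEDist {E : Type*} [PseudoEMetricSpace E]
    {X : Set E} {F : E → Set E}
    (hF : ∀ (xs : ℕ → E) (x : E), (∀ n, xs n ∈ X) → x ∈ X → Tendsto xs atTop (𝓝 x) →
      Tendsto (fun n => Metric.hausdorffEDist (F (xs n)) (F x)) atTop (𝓝 0))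
    {z : E} (hz : z ∈ X) (hc : IsCompact (F z)) {U : Set E} (hU : IsOpen U) (hzU : F z ⊆ U) :
    ∀ᶠ y in 𝓝[X] z, F y ⊆ U := by
  classical
  obtain ⟨δ, hδ, hδU⟩ := hc.exists_thickening_subset_open hU hzU
  rw [Filter.eventually_iff_seq_eventually]
  intro xs hxs
  obtain ⟨hxs1, hxs2⟩ := tendsto_nhdsWithin_iff.1 hxs
  let ys : ℕ → E := fun n => if xs n ∈ X then xs n else z
  have hys : ∀ᶠ n in atTop, xs n = ys n := hxs2.mono fun n hn => (if_pos hn).symm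
  have h := hF ys z (fun n => by by_cases h : xs n ∈ X <;> simp [ys, h, hz]) hz
    (hxs1.congr' hys)
  filter_upwards [h.eventually_lt_const (ENNReal.ofReal_pos.2 hδ), hys] with n hn hn'
  rw [hn']
  intro w hw
  obtain ⟨y, hy, hwy⟩ := Metric.exists_edist_lt_of_hausdorffEDist_lt hw hn
  exact hδU ((Metric.mem_thickening_iff_exists_edist_lt _ _).2 ⟨y, hy, hwy⟩)

/-- If arcs in `X` to the base point `p` vary upper semicontinuously, nonvanishing functions on
`X` have logarithms. -/
theorem exists_isLogOn_of_arcs {E : Type*} [TopologicalSpace E] [T2Space E] [NormalSpace E]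
    {X : Set E} {p : E} {F : E → Set E}
    (hp : F p = {p}) (hF : ∀ x ∈ X, x ≠ p → F x ⊆ X ∧ IsArcWithEndpoints (F x) x p)
    (husc : ∀ z ∈ X, ∀ U, IsOpen U → F z ⊆ U → ∀ᶠ y in 𝓝[X] z, F y ⊆ U)
    (hpX : p ∈ X) {W : Set E} (hW : IsOpen W) (hXW : X ⊆ W) {f : E → ℂ} (hf : ContinuousOn f W)
    (h0 : ∀ z ∈ W, f z ≠ 0) : ∃ ℓ, IsLogOn ℓ f X := by
  have hFX : ∀ z ∈ X, F z ⊆ X ∧ IsCompact (F z) ∧ IsPreconnected (F z) ∧ z ∈ F z ∧ p ∈ F z := by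
    intro z hz
    by_cases hzp : z = p
    · subst hzp
      simp [hp, hz, isPreconnected_singleton]
    · obtain ⟨h1, h2⟩ := hF z hz hzp
      exact ⟨h1, h2.isCompact, h2.isConnected.isPreconnected, h2.left_mem, h2.right_mem⟩
  have hlog : ∀ z : E, ∃ ℓ : E → ℂ, z ∈ X → IsLogOn ℓ f (F z) ∧ ℓ p = Complex.log (f p) := by
    intro z
    by_cases hz : z ∈ X
    swap
    · exact ⟨0, fun h => absurd h hz⟩
    have hFW := (hFX z hz).1.trans hXW
    obtain ⟨ℓ, hℓ⟩ : ∃ ℓ, IsLogOn ℓ f (F z) := by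
      by_cases hzp : z = p
      · subst hzp
        refine ⟨fun _ => Complex.log (f z), continuousOn_const, ?_⟩
        simp [hp, Complex.exp_log (h0 z (hXW hz))]
      · exact (hF z hz hzp).2.exists_isLogOn (hf.mono hFW) fun y hy => h0 y (hFW hy)
    refine ⟨fun y => ℓ y - ℓ p + Complex.log (f p), fun _ => ⟨⟨?_, fun y hy => ?_⟩, by simp⟩⟩
    · exact (hℓ.1.sub continuousOn_const).add continuousOn_const
    · rw [Complex.exp_add, Complex.exp_sub, hℓ.2 y hy, hℓ.2 p (hFX z hz).2.2.2.2,
        Complex.exp_log (h0 p (hXW hpX)), div_mul_cancel₀ _ (h0 p (hXW hpX))]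
  choose ℓ hℓ using hlog
  refine ⟨fun z => ℓ z z, fun z hz => ?_, fun z hz => (hℓ z hz).1.2 z (hFX z hz).2.2.2.1⟩
  obtain ⟨-, hc, -, hzz, hpz⟩ := hFX z hz
  obtain ⟨U, L, hU, hzU, -, hL, hLe⟩ :=
    (hℓ z hz).1.exists_open_extension hc.isClosed hW ((hFX z hz).1.trans hXW) hf
  have hLc : ContinuousWithinAt L X z := (hL.1.continuousAt (hU.mem_nhds (hzU hzz))).continuousWithinAt
  refine hLc.congr_of_eventuallyEq ?_ (hLe hzz).symm
  filter_upwards [husc z hz U hU hzU, self_mem_nhdsWithin] with y hy hyX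
  obtain ⟨-, -, hyc, hyy, hpy⟩ := hFX y hyX
  have := (hℓ y hyX).1.sub_eq (hL.mono hy) hyc hyy hpy
  rw [(hℓ y hyX).2, hLe hpz, (hℓ z hz).2, sub_self, sub_eq_zero] at this
  exact this

/-- Borsuk's criterion: a compact plane set on which all functions `z - w` have logarithms does
not separate the plane. -/
theorem IsCompact.isPreconnected_compl_of_isLogOn {X : Set Plane} (hX : IsCompact X)
    (hlog : ∀ w ∉ X, ∃ ℓ, IsLogOn ℓ (fun z => planeToComplex (z - w)) X) :
    IsPreconnected Xᶜ := by
  classical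
  obtain ⟨R, hR, hXR⟩ := hX.isBounded.subset_closedBall_lt 0 0
  have hR' : IsPreconnected (Metric.closedBall (0 : Plane) R)ᶜ := by
    have : (Metric.closedBall (0 : Plane) R)ᶜ =
        (fun q : ℝ × Plane => q.1 • q.2) '' (Ioi R ×ˢ Metric.sphere 0 1) := by
      ext z
      simp only [mem_compl_iff, mem_closedBall_zero_iff, not_le, mem_image, mem_prod, mem_Ioi,
        mem_sphere_zero_iff_norm, Prod.exists]
      constructor
      · intro hz
        have hz0 : ‖z‖ ≠ 0 := (hR.trans hz).ne'
        exact ⟨‖z‖, ‖z‖⁻¹ • z, ⟨hz, by rw [norm_smul]; simp [hz0]⟩, by rw [smul_smul]; simp [hz0]⟩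
      · rintro ⟨s, y, ⟨hs, hy⟩, rfl⟩
        rwa [norm_smul, hy, mul_one, Real.norm_of_nonneg (hR.trans hs).le]
    rw [this]
    exact (isPreconnected_Ioi.prod (isPreconnected_sphere one_lt_rank_plane _ _)).image _
      (by fun_prop)
  have hunb : ∀ w ∈ Xᶜ, ∃ y ∈ connectedComponentIn Xᶜ w, y ∈ (Metric.closedBall (0 : Plane) R)ᶜ := by
    intro w hw
    by_contra! hU
    obtain ⟨ℓ, hℓ⟩ := hlog w hw
    have hUo : IsOpen (connectedComponentIn Xᶜ w) := hX.isClosed.isOpen_compl.connectedComponentIn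
    have hfr : frontier (connectedComponentIn Xᶜ w) ⊆ X := by
      intro y hy
      by_contra hyX
      rw [hUo.frontier_eq] at hy
      have hyo : IsOpen (connectedComponentIn Xᶜ y) := hX.isClosed.isOpen_compl.connectedComponentIn
      obtain ⟨v, hv1, hv2⟩ := mem_closure_iff.1 hy.1 _ hyo (mem_connectedComponentIn hyX)
      have := (connectedComponentIn_eq hv1).trans (connectedComponentIn_eq hv2).symm
      exact hy.2 (this ▸ mem_connectedComponentIn hyX)
    obtain ⟨L, hL⟩ := ContinuousMap.exists_restrict_eq hX.isClosed
      (⟨X.domRestrict ℓ, continuousOn_iff_continuous_domRestrict.1 hℓ.1⟩ : C(X, ℂ))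
    have hLX : ∀ z ∈ X, L z = ℓ z := fun z hz => congrArg (fun g : C(X, ℂ) => g ⟨z, hz⟩) hL
    let G : Plane → ℂ := fun z =>
      if z ∈ connectedComponentIn Xᶜ w then Complex.exp (L z) else planeToComplex (z - w)
    have hG : Continuous G := by
      refine Continuous.if (fun z hz => ?_) (by fun_prop) (by fun_prop)
      rw [hLX z (hfr hz), hℓ.2 z (hfr hz)]
    have hG0 : ∀ z, G z ≠ 0 := by
      intro z
      by_cases hz : z ∈ connectedComponentIn Xᶜ w
      · simp [G, hz]
      · simp only [G, if_neg hz]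
        refine planeToComplex_sub_ne_zero ?_
        rintro rfl
        exact hz (mem_connectedComponentIn hw)
    obtain ⟨m, hm⟩ := exists_isLogOn_of_starConvex (mem_univ (0 : Plane))
      (convex_univ.starConvex (mem_univ _)) hG.continuousOn (fun z _ => hG0 z)
    have hwR : w ∈ Metric.closedBall (0 : Plane) R := by
      simpa using hU w (mem_connectedComponentIn hw)
    refine not_isLogOn_sphere w (r := 3 * R) (by positivity) m
      ⟨hm.1.mono (subset_univ _), fun z hz => ?_⟩
    rw [hm.2 z (mem_univ z)]
    refine if_neg fun hzU => ?_
    have h1 : z ∈ Metric.closedBall (0 : Plane) R := by simpa using hU z hzU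
    have h2 := dist_triangle_right z w 0
    rw [Metric.mem_sphere.1 hz] at h2
    have := Metric.mem_closedBall.1 h1
    have := Metric.mem_closedBall.1 hwR
    linarith
  refine isPreconnected_of_forall_pair fun a ha b hb => ?_
  obtain ⟨a', ha1, ha2⟩ := hunb a ha
  obtain ⟨b', hb1, hb2⟩ := hunb b hb
  refine ⟨connectedComponentIn Xᶜ a ∪ (Metric.closedBall (0 : Plane) R)ᶜ ∪
    connectedComponentIn Xᶜ b, ?_, Or.inl (Or.inl (mem_connectedComponentIn ha)),
    Or.inr (mem_connectedComponentIn hb), ?_⟩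
  · exact union_subset (union_subset (connectedComponentIn_subset _ _)
      (compl_subset_compl.2 hXR)) (connectedComponentIn_subset _ _)
  · exact (isPreconnected_connectedComponentIn.union a' ha1 ha2 hR').union b' (Or.inr hb2) hb1
      isPreconnected_connectedComponentIn

/-- If `g` is a logarithm of `(z - e) / (z - x)` off a closed set `B` without interior, then on
each small circle around `e` there is a point of `B` near which `g` differs from every local
logarithm by a nonconstant function. -/
theorem exists_jump {e x : Plane} {r : ℝ} (hr : 0 < r) (hx : r < dist x e) {B : Set Plane}
    (hBi : interior B = ∅) {g : Plane → ℂ} (hg : IsLogOn g (ratioMap e x) Bᶜ) :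
    ∃ t ∈ Metric.sphere e r ∩ B, ∀ δ > 0, ∀ h, IsLogOn h (ratioMap e x) (Metric.ball t δ) →
      ∃ a ∈ Metric.ball t δ \ B, ∃ b ∈ Metric.ball t δ \ B, g a - h a ≠ g b - h b := by
  by_contra! H
  have hd : ∀ z, z ∈ closure Bᶜ := fun z => by
    rw [closure_compl, hBi, compl_empty]; trivial
  have hlim : ∀ z ∈ Metric.sphere e r, ∃ y, Tendsto g (𝓝[Bᶜ] z) (𝓝 y) := by
    intro z hz
    by_cases hzB : z ∈ B
    · obtain ⟨δ, hδ, h, hh, hc⟩ := H z ⟨hz, hzB⟩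
      obtain ⟨a, ha1, ha2⟩ := mem_closure_iff.1 (hd z) _ Metric.isOpen_ball
        (Metric.mem_ball_self hδ)
      have hhz : ContinuousAt h z := hh.1.continuousAt (Metric.ball_mem_nhds z hδ)
      refine ⟨h z + (g a - h a),
        ((hhz.mono_left nhdsWithin_le_nhds).add_const (g a - h a)).congr' ?_⟩
      filter_upwards [self_mem_nhdsWithin,
        mem_nhdsWithin_of_mem_nhds (Metric.ball_mem_nhds z hδ)] with y hy1 hy2
      rw [hc a ⟨ha1, ha2⟩ y ⟨hy2, hy1⟩]
      ring
    · exact ⟨g z, hg.1 z hzB⟩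
  refine not_isLogOn_ratioMap_sphere hr hx (extendFrom Bᶜ g)
    ⟨continuousOn_extendFrom (fun z _ => hd z) hlim, fun z hz => ?_⟩
  have : (𝓝[Bᶜ] z).NeBot := mem_closure_iff_nhdsWithin_neBot.1 (hd z)
  have h1 := (Complex.continuous_exp.tendsto _).comp (tendsto_extendFrom (hlim z hz))
  have hzx : z ≠ x := by
    rintro rfl
    exact hx.ne' (Metric.mem_sphere.1 hz)
  have h2 : Tendsto (ratioMap e x) (𝓝[Bᶜ] z) (𝓝 (ratioMap e x z)) :=
    ((continuousOn_ratioMap e x).continuousAt (isOpen_compl_singleton.mem_nhds hzx)).mono_left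
      nhdsWithin_le_nhds
  refine tendsto_nhds_unique (h1.congr' ?_) h2
  filter_upwards [self_mem_nhdsWithin] with y hy using hg.2 y hy

/-- Two disjoint open sets covering a disc up to a compact set `X` without interior contain points
with different nearest points in `X`. -/
theorem exists_nearest_ne {X L R : Set Plane} (hX : IsCompact X) (hne : X.Nonempty)
    (hi : interior X = ∅) {t : Plane} {δ : ℝ} (hδ : 0 < δ) (hL : IsOpen L) (hR : IsOpen R)
    (hLR : Disjoint L R) (hLne : L.Nonempty) (hRne : R.Nonempty) (hLb : L ⊆ Metric.ball t δ)
    (hRb : R ⊆ Metric.ball t δ) (hcov : Metric.ball t δ \ X ⊆ L ∪ R) :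
    ∃ a ∈ L \ X, ∃ b ∈ R \ X, ∃ a' ∈ X, ∃ b' ∈ X, a' ≠ b' ∧
      (∀ y ∈ X, dist a a' ≤ dist a y) ∧ segment ℝ a' a ∩ X ⊆ {a'} ∧
      (∀ y ∈ X, dist b b' ≤ dist b y) ∧ segment ℝ b' b ∩ X ⊆ {b'} := by
  have hd : Dense Xᶜ := interior_eq_empty_iff_dense_compl.1 hi
  obtain ⟨b, hbR, hbX⟩ := hd.inter_open_nonempty R hR hRne
  obtain ⟨a₀, ha₀L, ha₀X⟩ := hd.inter_open_nonempty L hL hLne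
  obtain ⟨b', hb'X, hb'min, hb's⟩ := hX.exists_nearest_segment hne b
  have hRcl : Disjoint R (closure L) := hLR.symm.closure_right hR
  obtain ⟨w, hwb', hwL, hwX⟩ : ∃ w, w ≠ b' ∧ w ∈ closure L ∧ w ∈ X := by
    by_contra! hw
    obtain ⟨z, -, hz1, hz2⟩ := isPreconnected_ball_diff_singleton t b' hδ L (closure L)ᶜ hL
      isClosed_closure.isOpen_compl (by
        rintro z ⟨hz, hzb⟩
        by_cases hzL : z ∈ closure L
        · rcases hcov ⟨hz, hw z hzb hzL⟩ with h | h
          · exact Or.inl h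
          · exact absurd hzL (disjoint_left.1 hRcl h)
        · exact Or.inr hzL)
      ⟨a₀, ⟨hLb ha₀L, fun h => ha₀X (h ▸ hb'X)⟩, ha₀L⟩
      ⟨b, ⟨hRb hbR, fun h => hbX (h ▸ hb'X)⟩, disjoint_left.1 hRcl hbR⟩
    exact hz2 (subset_closure hz1)
  have hε : 0 < dist w b' / 2 := half_pos (dist_pos.2 hwb')
  obtain ⟨a, ⟨haw, haL⟩, haX⟩ := hd.inter_open_nonempty (Metric.ball w (dist w b' / 2) ∩ L)
    (Metric.isOpen_ball.inter hL) (mem_closure_iff.1 hwL _ Metric.isOpen_ball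
      (Metric.mem_ball_self hε))
  obtain ⟨a', ha'X, ha'min, ha's⟩ := hX.exists_nearest_segment hne a
  refine ⟨a, ⟨haL, haX⟩, b, ⟨hbR, hbX⟩, a', ha'X, b', hb'X, ?_, ha'min, ha's, hb'min, hb's⟩
  rintro rfl
  have h1 := ha'min w hwX
  have h2 := dist_triangle_left w a' a
  have h3 := Metric.mem_ball.1 haw
  linarith

/-- Let `C` be an arc in `X` with ends `a'` and `b'`, and let `h` be a logarithm of
`(z - e) / (z - x)` near `C` which differs from a logarithm `g` off `X` by different constants near
the ends of `C`. Then `C` can be completed to a simple closed curve separating `e` from `x`. -/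
theorem exists_separating_curve {X N C : Set Plane} {e x a b a' b' : Plane} {g h : Plane → ℂ}
    (hX : IsClosed X) (hXc : IsPreconnected Xᶜ) (he : e ∈ X) (hx : x ∈ X) (heC : e ∉ C)
    (hxC : x ∉ C) (hg : IsLogOn g (ratioMap e x) Xᶜ) (hN : IsOpen N)
    (hh : IsLogOn h (ratioMap e x) N) (hC : IsArcWithEndpoints C a' b') (hCX : C ⊆ X)
    (hCN : C ⊆ N) (ha : a ∉ X) (hb : b ∉ X) (ha's : segment ℝ a' a ∩ X ⊆ {a'})
    (hb's : segment ℝ b' b ∩ X ⊆ {b'}) (haN : segment ℝ a' a ⊆ N) (hbN : segment ℝ b' b ⊆ N)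
    (hab : g a - h a ≠ g b - h b) :
    ∃ σ, IsSimpleClosedCurve σ ∧ σ ∩ X ⊆ C ∧ SeparatesPoints σ e x := by
  have ha'X : a' ∈ X := hCX hC.left_mem
  have hb'X : b' ∈ X := hCX hC.right_mem
  have hne : a ≠ b := by rintro rfl; exact hab rfl
  have ha'b' := hC.ne
  have ha'a : a' ≠ a := fun h' => ha (h' ▸ ha'X)
  have hb'b : b' ≠ b := fun h' => hb (h' ▸ hb'X)
  have ha'b : a' ≠ b := fun h' => hb (h' ▸ ha'X)
  obtain ⟨M, hMX, hM⟩ := hXc.exists_arc hX.isOpen_compl ha hb hne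
  have hsa := isArcWithEndpoints_segment ha'a
  have hsb := isArcWithEndpoints_segment hb'b
  obtain ⟨κ₁, hκ₁, hκ₁'⟩ := hsa.exists_subset_union hM ha'b
  obtain ⟨κ, hκ', hκ⟩ := hκ₁'.exists_subset_union hsb.symm ha'b'
  replace hκ' : κ ⊆ segment ℝ a' a ∪ M ∪ segment ℝ b' b :=
    hκ'.trans (union_subset_union_left _ hκ₁)
  have hκX : κ ∩ X ⊆ {a', b'} := by
    rintro z ⟨hz, hzX⟩
    rcases hκ' hz with (hz | hz) | hz
    · exact Or.inl (ha's ⟨hz, hzX⟩)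
    · exact absurd hzX (hMX hz)
    · exact Or.inr (hb's ⟨hz, hzX⟩)
  have hσX : (C ∪ κ) ∩ X ⊆ C := by
    rintro z ⟨hz | hz, hzX⟩
    · exact hz
    · rcases hκX ⟨hz, hzX⟩ with rfl | rfl
      exacts [hC.left_mem, hC.right_mem]
  have hcurve : IsSimpleClosedCurve (C ∪ κ) :=
    hC.isSimpleClosedCurve_union hκ fun z hz => hκX ⟨hz.2, hCX hz.1⟩
  have hclosed : IsClosed (C ∪ κ) := hC.isCompact.isClosed.union hκ.isCompact.isClosed
  refine ⟨C ∪ κ, hcurve, hσX, fun h' => heC (hσX ⟨h', he⟩), fun h' => hxC (hσX ⟨h', hx⟩), ?_⟩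
  intro K hK hKc heK hxK
  obtain ⟨ℓ, hℓ⟩ : ∃ ℓ, IsLogOn ℓ (ratioMap e x) (C ∪ κ) := by
    have hU : IsConnected (connectedComponentIn (C ∪ κ)ᶜ e) :=
      isConnected_connectedComponentIn_iff.2 (hK heK)
    have hsub := hKc.subset_connectedComponentIn heK hK
    obtain ⟨γ, hγ⟩ := (hclosed.isOpen_compl.connectedComponentIn.isConnected_iff_isPathConnected.1
      hU).joinedIn x (hsub hxK) e (hsub heK)
    obtain ⟨ℓ, hℓ⟩ := exists_isLogOn_ratioMap γ
    refine ⟨ℓ, hℓ.mono fun z hz hzγ => ?_⟩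
    obtain ⟨s, rfl⟩ := hzγ
    exact connectedComponentIn_subset _ _ (hγ s) hz
  obtain ⟨hκc, ha'cl⟩ := hκ.isPreconnected_diff_pair
  obtain ⟨-, hb'cl⟩ := hκ.symm.isPreconnected_diff_pair
  rw [pair_comm] at hb'cl
  have hκoX : κ \ {a', b'} ⊆ Xᶜ := fun z hz hzX => hz.2 (hκX ⟨hz.1, hzX⟩)
  have hκσ : κ \ {a', b'} ⊆ C ∪ κ := sdiff_subset.trans subset_union_right
  obtain ⟨z₀, hz₀⟩ : (κ \ {a', b'}).Nonempty := closure_nonempty_iff.1 ⟨_, ha'cl⟩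
  have key : ∀ (c c' : Plane) (Z : Set Plane), c' ∈ C → IsClosed Z → c' ∉ Z →
      κ ⊆ segment ℝ c' c ∪ Z → segment ℝ c' c ∩ X ⊆ {c'} → segment ℝ c' c ⊆ N → c ∉ X →
      c' ∈ closure (κ \ {a', b'}) → ℓ c' - h c' = ℓ z₀ - g z₀ + (g c - h c) := by
    intro c c' Z hc' hZ hc'Z hκZ hsX hsN hcX hcl
    have : (𝓝[κ \ {a', b'}] c').NeBot := mem_closure_iff_nhdsWithin_neBot.1 hcl
    have hcc' : c' ≠ c := fun h' => hcX (h' ▸ hCX hc')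
    have hlim : Tendsto (fun z => ℓ z - h z) (𝓝[κ \ {a', b'}] c') (𝓝 (ℓ c' - h c')) :=
      ((hℓ.1 c' (Or.inl hc')).mono hκσ).sub
        (hh.1.continuousAt (hN.mem_nhds (hCN hc'))).continuousWithinAt
    refine tendsto_nhds_unique hlim (tendsto_const_nhds.congr' ?_)
    filter_upwards [self_mem_nhdsWithin,
      mem_nhdsWithin_of_mem_nhds (hZ.isOpen_compl.mem_nhds hc'Z)] with z hz hzZ
    have h1 := (hℓ.mono hκσ).sub_eq (hg.mono hκoX) hκc hz hz₀
    have hzs : z ∈ segment ℝ c' c := (hκZ hz.1).resolve_right hzZ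
    have hsub : segment ℝ c' c \ {c'} ⊆ Xᶜ := fun y hy hyX => hy.2 (hsX ⟨hy.1, hyX⟩)
    have h2 := (hg.mono hsub).sub_eq (hh.mono (sdiff_subset.trans hsN))
      (isArcWithEndpoints_segment hcc').isPreconnected_diff_singleton_left
      (y := z) (z := c) ⟨hzs, fun h' => hκoX hz (mem_singleton_iff.1 h' ▸ hCX hc')⟩
      ⟨right_mem_segment _ _ _, hcc'.symm⟩
    linear_combination -h1 - h2
  have h1 := key a a' (M ∪ segment ℝ b' b) hC.left_mem
    (hM.isCompact.isClosed.union hsb.isCompact.isClosed)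
    (by
      rintro (h' | h')
      · exact hMX h' ha'X
      · exact ha'b' (hb's ⟨h', ha'X⟩))
    (by rwa [← union_assoc]) ha's haN ha ha'cl
  have h2 := key b b' (segment ℝ a' a ∪ M) hC.right_mem
    (hsa.isCompact.isClosed.union hM.isCompact.isClosed)
    (by
      rintro (h' | h')
      · exact ha'b' (ha's ⟨h', hb'X⟩).symm
      · exact hMX h' hb'X)
    (by rwa [union_comm]) hb's hbN hb hb'cl
  have h3 := (hℓ.mono subset_union_left).sub_eq (hh.mono hCN) hC.isConnected.isPreconnected
    hC.left_mem hC.right_mem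
  apply hab
  linear_combination h3 - h1 + h2

/-- Theorem 9. -/
theorem stmt_11 (X : Set Plane) (p : Plane) (hX : IsDendroid X) (hp : DendroidSmoothAt X p)
    (e : Plane) (he : e ∈ Endpoints X \ {p})
    (A : Set Plane) (hAX : A ⊆ X) (hA : IsArcWithEndpoints A e p)
    (x : Plane) (hx : x ∈ X \ A) :
    ∃ σ : Set Plane, IsSimpleClosedCurve σ ∧ SeparatesPoints σ e x ∧
      (σ ∩ Endpoints X).encard ≤ 2 ∧ p ∉ σ ∩ Endpoints X := by
  obtain ⟨hXc, -, hHU, -⟩ := hX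
  obtain ⟨hpX, F, hFp, hF, hFlim⟩ := hp
  obtain ⟨heE, hep⟩ := he
  obtain ⟨hxX, hxA⟩ := hx
  have heX : e ∈ X := heE.1
  have hxp : x ≠ p := fun h => hxA (h ▸ hA.right_mem)
  have hxe : x ≠ e := fun h => hxA (h ▸ hA.left_mem)
  obtain ⟨hFxX, hFx⟩ := hF x hxX hxp
  have heFx : e ∉ F x := fun h =>
    (hFx.eq_or_eq_of_mem_endpoints hFxX heE h).elim (fun h => hxe h.symm) hep
  have hFcompact : ∀ z ∈ X, IsCompact (F z) := fun z hz => by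
    by_cases hzp : z = p
    · rw [hzp, hFp]; exact isCompact_singleton
    · exact (hF z hz hzp).2.isCompact
  have husc : ∀ z ∈ X, ∀ U, IsOpen U → F z ⊆ U → ∀ᶠ y in 𝓝[X] z, F y ⊆ U := fun z hz U hU hzU =>
    eventually_subset_of_tendsto_hausdorffEDist hFlim hz (hFcompact z hz) hU hzU
  have hXpre : IsPreconnected Xᶜ := hXc.isPreconnected_compl_of_isLogOn fun w hw =>
    exists_isLogOn_of_arcs hFp hF husc hpX isOpen_compl_singleton (W := {w}ᶜ)
      (fun z hz h => hw (mem_singleton_iff.1 h ▸ hz)) (by fun_prop)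
      fun z hz => planeToComplex_sub_ne_zero hz
  have hXi : interior X = ∅ := hHU.interior_eq_empty
  obtain ⟨B, hBsub, hB⟩ := hA.exists_subset_union hFx.symm hxe.symm
  have hBX : B ⊆ X := hBsub.trans (union_subset hAX hFxX)
  obtain ⟨γ, hγ⟩ := hB.symm.exists_path
  obtain ⟨g, hg⟩ := exists_isLogOn_ratioMap γ
  rw [hγ] at hg
  obtain ⟨r, hr, hrF⟩ := Metric.nhds_basis_closedBall.mem_iff.1
    (hFx.isCompact.isClosed.isOpen_compl.mem_nhds heFx)
  have hrx : r < dist x e := not_le.1 fun h => hrF (Metric.mem_closedBall.2 h) hFx.left_mem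
  obtain ⟨t, ⟨htS, htB⟩, hjump⟩ := exists_jump hr hrx
    (subset_empty_iff.1 ((interior_mono hBX).trans hXi.subset)) hg
  have htF : t ∉ F x := hrF (Metric.sphere_subset_closedBall htS)
  have htA : t ∈ A := (hBsub htB).resolve_right htF
  have htp : t ≠ p := fun h => htF (h ▸ hFx.right_mem)
  have hte : t ≠ e := fun h => hr.ne (by simpa [h] using htS)
  obtain ⟨D, hDA, hD, heD⟩ := hA.exists_subarc htA htp
  have hFt := hF t (hAX htA) htp
  have hFtD : F t ⊆ D := hHU.arc_subset hFt.1 (hDA.trans hAX) hFt.2 hD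
  have hFtW : F t ⊆ {e, x}ᶜ := by
    rintro z hz (rfl | rfl)
    · exact heD hte (hFtD hz)
    · exact hxA (hDA (hFtD hz))
  have hWo : IsOpen ({e, x}ᶜ : Set Plane) := (Set.toFinite _).isClosed.isOpen_compl
  have hfW : ContinuousOn (ratioMap e x) {e, x}ᶜ :=
    (continuousOn_ratioMap e x).mono (compl_subset_compl.2 (by simp))
  obtain ⟨h₀, hh₀⟩ := hFt.2.exists_isLogOn (hfW.mono hFtW) fun z hz =>
    ratioMap_ne_zero (fun h => hFtW hz (Or.inl h)) (fun h => hFtW hz (Or.inr h))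
  obtain ⟨N, h, hN, hFtN, hNW, hh, -⟩ :=
    hh₀.exists_open_extension hFt.2.isCompact.isClosed hWo hFtW hfW
  have hev : ∀ᶠ y in 𝓝 t, y ∈ N ∧ y ≠ p ∧ (y ∈ X → F y ⊆ N) := by
    filter_upwards [hN.mem_nhds (hFtN hFt.2.left_mem), isOpen_compl_singleton.mem_nhds htp,
      eventually_nhdsWithin_iff.1 (husc t (hAX htA) N hN hFtN)] with y h1 h2 h3
    exact ⟨h1, h2, h3⟩
  obtain ⟨δ, hδ, hball⟩ := Metric.eventually_nhds_iff_ball.1 hev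
  have hδ2 : 0 < δ / 2 := half_pos hδ
  have hsub2 : Metric.ball t (δ / 2) ⊆ Metric.ball t δ := Metric.ball_subset_ball (by linarith)
  have hOo : IsOpen (Metric.ball t (δ / 2) \ B) := Metric.isOpen_ball.sdiff hB.isCompact.isClosed
  obtain ⟨a₀, ha₀, b₀, hb₀, hab₀⟩ := hjump (δ / 2) hδ2 h (hh.mono fun z hz => (hball z (hsub2 hz)).1)
  have hconst : ∀ z ∈ Metric.ball t (δ / 2) \ B, ∃ ε > 0,
      Metric.ball z ε ⊆ Metric.ball t (δ / 2) \ B ∧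
      ∀ y ∈ Metric.ball z ε, g y - h y = g z - h z := by
    intro z hz
    obtain ⟨ε, hε, hεO⟩ := Metric.isOpen_iff.1 hOo z hz
    exact ⟨ε, hε, hεO, fun y hy =>
      (hg.mono fun w hw => (hεO hw).2).sub_eq (hh.mono fun w hw => (hball w (hsub2 (hεO hw).1)).1)
        (convex_ball z ε).isPreconnected hy (Metric.mem_ball_self hε)⟩
  have hopen : ∀ Q : ℂ → Prop, IsOpen {z ∈ Metric.ball t (δ / 2) \ B | Q (g z - h z)} := by
    intro Q
    refine Metric.isOpen_iff.2 fun z hz => ?_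
    obtain ⟨ε, hε, hεO, hεc⟩ := hconst z hz.1
    exact ⟨ε, hε, fun y hy => ⟨hεO hy, by rw [hεc y hy]; exact hz.2⟩⟩
  obtain ⟨a, ⟨haL, haX⟩, b, ⟨hbR, hbX⟩, a', ha'X, b', hb'X, hne, ha'min, ha's, hb'min, hb's⟩ :=
    exists_nearest_ne hXc ⟨p, hpX⟩ hXi hδ2 (hopen (· = g a₀ - h a₀)) (hopen (· ≠ g a₀ - h a₀))
      (disjoint_left.2 fun z hz hz' => hz'.2 hz.2) ⟨a₀, ha₀, rfl⟩ ⟨b₀, hb₀, hab₀.symm⟩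
      (fun z hz => hz.1.1) (fun z hz => hz.1.1) (fun z hz => by
        by_cases hzk : g z - h z = g a₀ - h a₀
        · exact Or.inl ⟨⟨hz.1, fun h => hz.2 (hBX h)⟩, hzk⟩
        · exact Or.inr ⟨⟨hz.1, fun h => hz.2 (hBX h)⟩, hzk⟩)
  have hnear : ∀ c c' : Plane, c ∈ Metric.ball t (δ / 2) → (∀ y ∈ X, dist c c' ≤ dist c y) →
      c' ∈ Metric.ball t δ := by
    intro c c' hc hmin
    have h1 := hmin t (hAX htA)
    have h2 := dist_triangle_left c' t c
    have h3 := Metric.mem_ball.1 hc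
    rw [Metric.mem_ball]
    linarith
  have ha'b := hnear a a' haL.1.1 ha'min
  have hb'b := hnear b b' hbR.1.1 hb'min
  have hsegN : ∀ c c' : Plane, c ∈ Metric.ball t (δ / 2) → c' ∈ Metric.ball t δ →
      segment ℝ c' c ⊆ N := fun c c' hc hc' z hz =>
    (hball z ((convex_ball t δ).segment_subset hc' (hsub2 hc) hz)).1
  obtain ⟨-, ha'p, ha'F⟩ := hball a' ha'b
  obtain ⟨-, hb'p, hb'F⟩ := hball b' hb'b
  have hFa := hF a' ha'X ha'p
  have hFb := hF b' hb'X hb'p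
  obtain ⟨C, hCsub, hC⟩ := hFa.2.exists_subset_union hFb.2.symm hne
  have hCX : C ⊆ X := hCsub.trans (union_subset hFa.1 hFb.1)
  have hCN : C ⊆ N := hCsub.trans (union_subset (ha'F ha'X) (hb'F hb'X))
  obtain ⟨σ, hσ, hσX, hsep⟩ := exists_separating_curve hXc.isClosed hXpre heX hxX
    (fun h => hNW (hCN h) (Or.inl rfl)) (fun h => hNW (hCN h) (Or.inr rfl))
    (hg.mono (compl_subset_compl.2 hBX)) hN hh hC hCX hCN haX hbX ha's hb's
    (hsegN a a' haL.1.1 ha'b) (hsegN b b' hbR.1.1 hb'b) (fun h => hbR.2 (h.symm.trans haL.2))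
  have hends : σ ∩ Endpoints X ⊆ {a', b'} := fun z hz =>
    hC.eq_or_eq_of_mem_endpoints hCX hz.2 (hσX ⟨hz.1, hz.2.1⟩)
  refine ⟨σ, hσ, hsep, (encard_le_encard hends).trans (encard_pair hne).le, fun hpσ => ?_⟩
  rcases hends hpσ with h | h
  exacts [ha'p h.symm, hb'p h.symm]
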